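/- Let p ≥ 1 and let ℓ_1, …, ℓ_p be the Lagrange basis polynomials for the p Chebyshev nodes of the first kind x_j = cos((2j−1)π/(2p)) on [−1,1]. Then for every x ∈ ℝ, ∑_{k=1}^p ℓ_k(x)² = 1 + (1/(2p)) (U_{2p−2}(x) − 1), where U_n denotes the degree-n Chebyshev polynomial of the second kind. -/

import Mathlib

noncomputable section

/-- The `j`-th Chebyshev node of the first kind on `[-1,1]`, for `p` nodes
(0-indexed: `x_j = cos((2j+1)π/(2p))`). -/
def chebNode (p : ℕ) (j : Fin p) : ℝ :=
  Real.cos ((2 * (j : ℝ) + 1) * Real.pi / (2 * p))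

/-- The Lagrange basis polynomial for the `p` Chebyshev nodes of the first kind,
evaluated at `x`. -/
def chebLagrange (p : ℕ) (k : Fin p) (x : ℝ) : ℝ :=
  (Lagrange.basis Finset.univ (chebNode p) k).eval x

section

open Polynomial Polynomial.Chebyshev Matrix

theorem chebNode_injective (p : ℕ) : Function.Injective (chebNode p) := by
  intro i j h
  have := (Finset.range p).nodup_map_iff_injOn.mp (roots_T_real_nodup p)
  exact Fin.ext (this (by simp) (by simp) h)

theorem sum_eval_T_chebNode (p : ℕ) {m : ℤ} (hm : ¬ (2 * p : ℤ) ∣ m) :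
    ∑ k : Fin p, (T ℝ m).eval (chebNode p k) = 0 := by
  rcases eq_or_ne p 0 with rfl | hp
  · simp
  have h := sumZeroes_T_of_not_dvd hm
  rw [sumZeroes, mul_eq_zero_iff_left (by simp [hp, Real.pi_ne_zero])] at h
  rw [← h, ← Fin.sum_univ_eq_sum_range
    (fun k ↦ (T ℝ m).eval (Real.cos ((2 * k + 1) / (2 * p) * Real.pi)))]
  refine Finset.sum_congr rfl fun k _ ↦ ?_
  rw [chebNode, div_mul_eq_mul_div]

/-- Discrete orthogonality of the Chebyshev polynomials of the first kind. -/
theorem sum_eval_T_mul_eval_T_chebNode {p : ℕ} (m n : Fin p) :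
    ∑ k : Fin p, (T ℝ m).eval (chebNode p k) * (T ℝ n).eval (chebNode p k)
      = if m = n then (if (m : ℕ) = 0 then (p : ℝ) else p / 2) else 0 := by
  have hprod : 2 * ∑ k : Fin p, (T ℝ m).eval (chebNode p k) * (T ℝ n).eval (chebNode p k)
      = ∑ k : Fin p, (T ℝ (m + n)).eval (chebNode p k)
        + ∑ k : Fin p, (T ℝ (m - n)).eval (chebNode p k) := by
    rw [Finset.mul_sum, ← Finset.sum_add_distrib]
    refine Finset.sum_congr rfl fun k _ ↦ ?_
    simpa [mul_assoc] using congrArg (eval (chebNode p k)) (T_mul_T ℝ m n)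
  have not_dvd {a : ℤ} (h₀ : a ≠ 0) (h₁ : |a| < 2 * p) : ¬ (2 * p : ℤ) ∣ a :=
    fun h ↦ h₀ (Int.eq_zero_of_abs_lt_dvd h h₁)
  have hm := m.isLt
  have hn := n.isLt
  split_ifs with hmn h0
  · subst hmn
    simp [h0]
  · subst hmn
    rw [sum_eval_T_chebNode p (not_dvd (by lia) (by rw [abs_lt]; lia))] at hprod
    simp only [sub_self, T_zero, eval_one, Finset.sum_const, Finset.card_univ, Fintype.card_fin,
      nsmul_eq_mul, mul_one] at hprod
    linarith
  · have hne : (m : ℕ) ≠ n := fun h ↦ hmn (Fin.ext h)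
    rw [sum_eval_T_chebNode p (not_dvd (by lia) (by rw [abs_lt]; lia)),
      sum_eval_T_chebNode p (not_dvd (by lia) (by rw [abs_lt]; lia))] at hprod
    linarith

theorem sum_eval_mul_chebLagrange {p : ℕ} {f : ℝ[X]} (hf : f.degree < p) (x : ℝ) :
    ∑ k : Fin p, f.eval (chebNode p k) * chebLagrange p k x = f.eval x := by
  have h := congrArg (eval x) <| Lagrange.eq_interpolate (s := Finset.univ) (f := f)
    (chebNode_injective p).injOn (by simpa using hf)
  rw [Lagrange.interpolate_apply, eval_finsetSum] at h
  simpa [chebLagrange] using h.symm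

theorem chebLagrange_sq_sum_eq_sum_eval_T {p : ℕ} (hp : p ≠ 0) (x : ℝ) :
    ∑ k : Fin p, chebLagrange p k x ^ 2
      = 1 / p * ∑ m ∈ Finset.range p, (if m = 0 then 1 else 2) * (T ℝ m).eval x ^ 2 := by
  have hp' : (p : ℝ) ≠ 0 := by exact_mod_cast hp
  let c : Fin p → ℝ := fun m ↦ 1 / p * if (m : ℕ) = 0 then 1 else 2
  let A : Matrix (Fin p) (Fin p) ℝ := .of fun k m ↦ (T ℝ m).eval (chebNode p k)
  let B : Matrix (Fin p) (Fin p) ℝ := .of fun m k ↦ c m * (T ℝ m).eval (chebNode p k)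
  let l : Fin p → ℝ := fun k ↦ chebLagrange p k x
  let t : Fin p → ℝ := fun m ↦ (T ℝ m).eval x
  have hBA : B * A = 1 := by
    ext m n
    simp only [Matrix.mul_apply, Matrix.of_apply, Matrix.one_apply, A, B, mul_assoc]
    rw [← Finset.mul_sum, sum_eval_T_mul_eval_T_chebNode]
    simp only [c]
    split_ifs <;> field_simp <;> simp
  have ht (m : Fin p) : ∑ k, (T ℝ m).eval (chebNode p k) * l k = t m :=
    sum_eval_mul_chebLagrange (by simp [degree_T]) x
  have hl : l ᵥ* A = t := by
    ext m
    simp [Matrix.vecMul, dotProduct, A, ← ht, mul_comm]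
  have hB : B *ᵥ l = fun m ↦ c m * t m := by
    ext m
    simp [Matrix.mulVec, dotProduct, B, ← ht, Finset.mul_sum, mul_assoc]
  calc ∑ k : Fin p, chebLagrange p k x ^ 2 = l ⬝ᵥ ((A * B) *ᵥ l) := by
        simp [mul_eq_one_comm.mp hBA, dotProduct, l, sq]
    _ = t ⬝ᵥ fun m ↦ c m * t m := by
        rw [← Matrix.mulVec_mulVec, Matrix.dotProduct_mulVec, hl, hB]
    _ = _ := by
        rw [← Fin.sum_univ_eq_sum_range
          (fun m ↦ (if m = 0 then (1 : ℝ) else 2) * (T ℝ m).eval x ^ 2), Finset.mul_sum]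
        refine Finset.sum_congr rfl fun m _ ↦ ?_
        simp only [t, c]
        ring

theorem sum_eval_T_sq (n : ℕ) (x : ℝ) :
    ∑ m ∈ Finset.range (n + 1), (if m = 0 then 1 else 2) * (T ℝ m).eval x ^ 2
      = n + 1 + ((U ℝ (2 * n)).eval x - 1) / 2 := by
  induction n with
  | zero => simp
  | succ n ih =>
    have hT : 2 * (T ℝ (n + 1)).eval x ^ 2 = (T ℝ (2 * n + 2)).eval x + 1 := by
      have h := congrArg (eval x) (T_mul_T ℝ (n + 1) (n + 1))
      rw [show (n + 1 + (n + 1) : ℤ) = 2 * n + 2 by ring] at h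
      simpa [mul_assoc, ← sq] using h
    have hU : (U ℝ (2 * n + 2)).eval x = 2 * (T ℝ (2 * n + 2)).eval x + (U ℝ (2 * n)).eval x := by
      simpa using congrArg (eval x) (U_eq_two_mul_T_add_U ℝ (2 * n))
    rw [Finset.sum_range_succ, ih, if_neg n.succ_ne_zero]
    push_cast
    rw [show (2 * (n + 1) : ℤ) = 2 * n + 2 by ring, hU, hT]
    ring

end

/-- Identity for the sum of squares of the Lagrange basis polynomials for the
Chebyshev nodes of the first kind:
`∑_k ℓ_k(x)² = 1 + (1/(2p))(U_{2p-2}(x) - 1)` for all real `x`. -/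
theorem chebLagrange_sq_sum_eq (p : ℕ) (hp : 1 ≤ p) (x : ℝ) :
    ∑ k : Fin p, chebLagrange p k x ^ 2
      = 1 + 1 / (2 * (p : ℝ)) * ((Polynomial.Chebyshev.U ℝ (2 * (p : ℤ) - 2)).eval x - 1) := by
  obtain ⟨n, rfl⟩ := Nat.exists_eq_add_of_le' hp
  rw [chebLagrange_sq_sum_eq_sum_eval_T n.succ_ne_zero, sum_eval_T_sq]
  have hn : (n : ℝ) + 1 ≠ 0 := by positivity
  push_cast
  rw [show (2 * (n + 1) - 2 : ℤ) = 2 * n by ring]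
  field_simp

end
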